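/- In a nonlinear model (p_k ≠ k/m for some 0 ≤ k ≤ m) with X_0 > 0 and Y_0 > 0: if 0 ∈ Z_P and there exists ε > 0 with P < 0 on (0, ε), then P(lim_{n→∞} a_n = 0) > 0; and if 1 ∈ Z_P and there exists ε > 0 with P > 0 on (1−ε, 1), then P(lim_{n→∞} a_n = 1) > 0. -/

import Mathlib

open MeasureTheory ProbabilityTheory Filter Set

noncomputable section

/-- The polynomial `P(z) = (1/2) ∑_{k=0}^m C(m,k) z^k (1-z)^{m-k} (p_k - k/m)`. -/
def polyP (m : ℕ) (p : ℕ → ℝ) (z : ℝ) : ℝ :=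
  (1 / 2) * ∑ k ∈ Finset.range (m + 1),
    (m.choose k : ℝ) * z ^ k * (1 - z) ^ (m - k) * (p k - (k : ℝ) / m)

/-- The zero set `Z_P = {z ∈ [0,1] : P(z) = 0}`. -/
def zeroSetP (m : ℕ) (p : ℕ → ℝ) : Set ℝ :=
  {z ∈ Set.Icc (0 : ℝ) 1 | polyP m p z = 0}

/-- The two-type preferential attachment process with `m` edges per new node and type
adoption parameters `p 0, …, p m`, defined on a probability space `(Ω, μ)` with filtration
`F`.  `A n` is the number of red nodes and `X n` the sum of the degrees of red nodes at time
`n`; the transition probabilities given `F n` are those of the model: a number `k` of red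
neighbours is drawn from the `Binomial(m, x_n)` distribution, and then the new node is red
with probability `p k` (adding `1` to the red nodes and `k + m` to the red degrees) and blue
with probability `1 - p k` (adding `k` to the red degrees). -/
structure PAProcess (Ω : Type) [MeasurableSpace Ω] where
  μ : Measure Ω
  isProb : IsProbabilityMeasure μ
  m : ℕ
  hm : 1 ≤ m
  p : ℕ → ℝ
  hp : ∀ k ≤ m, p k ∈ Set.Icc (0 : ℝ) 1
  A : ℕ → Ω → ℕ
  X : ℕ → Ω → ℕ
  F : Filtration ℕ ‹MeasurableSpace Ω›
  A0 : ℕ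
  B0 : ℕ
  X0 : ℕ
  Y0 : ℕ
  hA0 : ∀ ω, A 0 ω = A0
  hX0 : ∀ ω, X 0 ω = X0
  adaptedA : ∀ n, Measurable[F n] (A n)
  adaptedX : ∀ n, Measurable[F n] (X n)
  hXle : ∀ n ω, X n ω ≤ X0 + Y0 + 2 * m * n
  step_red : ∀ n, ∀ k ≤ m,
    μ[Set.indicator {ω | A (n + 1) ω = A n ω + 1 ∧ X (n + 1) ω = X n ω + k + m}
        (fun _ => (1 : ℝ)) | F n]
      =ᵐ[μ] fun ω => (m.choose k : ℝ) *
        ((X n ω : ℝ) / ((X0 : ℝ) + Y0 + 2 * m * n)) ^ k *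
        (1 - (X n ω : ℝ) / ((X0 : ℝ) + Y0 + 2 * m * n)) ^ (m - k) * p k
  step_blue : ∀ n, ∀ k ≤ m,
    μ[Set.indicator {ω | A (n + 1) ω = A n ω ∧ X (n + 1) ω = X n ω + k}
        (fun _ => (1 : ℝ)) | F n]
      =ᵐ[μ] fun ω => (m.choose k : ℝ) *
        ((X n ω : ℝ) / ((X0 : ℝ) + Y0 + 2 * m * n)) ^ k *
        (1 - (X n ω : ℝ) / ((X0 : ℝ) + Y0 + 2 * m * n)) ^ (m - k) * (1 - p k)

namespace PAProcess

variable {Ω : Type} [MeasurableSpace Ω] (P : PAProcess Ω)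

/-- Total degree `S_n = S_0 + 2mn`. -/
def S (n : ℕ) : ℕ := P.X0 + P.Y0 + 2 * P.m * n

/-- Normalized red degree `x_n = X_n / S_n`. -/
def x (n : ℕ) (ω : Ω) : ℝ := (P.X n ω : ℝ) / (P.S n : ℝ)

/-- Normalized red node count `a_n = A_n / (A_0 + B_0 + n)`. -/
def a (n : ℕ) (ω : Ω) : ℝ := (P.A n ω : ℝ) / ((P.A0 : ℝ) + P.B0 + n)

/-- The polynomial `P` of the process. -/
def poly : ℝ → ℝ := polyP P.m P.p

/-- The zero set `Z_P` of the process. -/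
def Zp : Set ℝ := zeroSetP P.m P.p

end PAProcess

def Gs {Ω : Type} (x : ℕ → Ω → ℝ) (E : Set Ω) (ε : ℝ) : ℕ → Set Ω
  | 0 => E
  | n + 1 => Gs x E ε n ∩ {ω | x (n + 1) ω < ε}

def Vs {Ω : Type} (x : ℕ → Ω → ℝ) (E : Set Ω) (ε : ℝ) : ℕ → Ω → ℝ
  | 0 => E.indicator (x 0)
  | n + 1 => fun ω => Vs x E ε n ω + (Gs x E ε n).indicator (fun ω => x (n + 1) ω - x n ω) ω

lemma Gs_sub {Ω : Type} (x : ℕ → Ω → ℝ) (E : Set Ω) (ε : ℝ) (n : ℕ) : Gs x E ε n ⊆ E := by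
  induction n with
  | zero => exact subset_rfl
  | succ n ih => exact inter_subset_left.trans ih

lemma Vs_inv {Ω : Type} (x : ℕ → Ω → ℝ) (E : Set Ω) (ε : ℝ)
    (h0 : ∀ n ω, 0 ≤ x n ω) (h1 : ∀ n ω, x n ω ≤ 1) (n : ℕ) (ω : Ω) :
    (ω ∈ Gs x E ε n → Vs x E ε n ω = x n ω) ∧ (ω ∈ E → ω ∉ Gs x E ε n → ε ≤ Vs x E ε n ω) ∧
      0 ≤ Vs x E ε n ω ∧ Vs x E ε n ω ≤ 1 := by
  induction n with
  | zero =>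
    by_cases h : ω ∈ E
    · simp [Gs, Vs, h, h0, h1]
    · simp [Gs, Vs, h]
  | succ n ih =>
    obtain ⟨i1, i2, i3, i4⟩ := ih
    by_cases h : ω ∈ Gs x E ε n
    · have := i1 h
      simp only [Vs, Gs, Set.indicator_of_mem h, this, mem_inter_iff, h, true_and, mem_ofPred_eq,
        not_lt]
      refine ⟨fun _ => by ring, fun _ h' => by linarith, ?_, ?_⟩
      · linarith [h0 (n+1) ω]
      · linarith [h1 (n+1) ω]
    · simp only [Vs, Gs, Set.indicator_of_notMem h, mem_inter_iff, h, false_and, add_zero]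
      exact ⟨fun h => h.elim, fun hE _ => i2 hE h, i3, i4⟩

lemma Gs_meas {Ω : Type} [mΩ : MeasurableSpace Ω] (F : Filtration ℕ mΩ) (x : ℕ → Ω → ℝ)
    (E : Set Ω) (ε : ℝ)
    (hx : ∀ n, Measurable[F n] (x n)) (hE : MeasurableSet[F 0] E) (n : ℕ) :
    MeasurableSet[F n] (Gs x E ε n) := by
  induction n with
  | zero => exact hE
  | succ n ih =>
    exact MeasurableSet.inter (F.mono (Nat.le_succ n) _ ih) (hx (n+1) measurableSet_Iio)

lemma Vs_meas {Ω : Type} [mΩ : MeasurableSpace Ω] (F : Filtration ℕ mΩ) (x : ℕ → Ω → ℝ)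
    (E : Set Ω) (ε : ℝ)
    (hx : ∀ n, Measurable[F n] (x n)) (hE : MeasurableSet[F 0] E) (n : ℕ) :
    Measurable[F n] (Vs x E ε n) := by
  induction n with
  | zero => exact (hx 0).indicator hE
  | succ n ih =>
    have a1 : Measurable[F (n+1)] (Vs x E ε n) := ih.mono (F.mono (Nat.le_succ n)) le_rfl
    have a2 : Measurable[F (n+1)] (x n) := (hx n).mono (F.mono (Nat.le_succ n)) le_rfl
    exact a1.add (((hx (n+1)).sub a2).indicator (F.mono (Nat.le_succ n) _ (Gs_meas F x E ε hx hE n)))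

theorem core {Ω : Type} [mΩ : MeasurableSpace Ω] (μ : Measure Ω) [IsProbabilityMeasure μ]
    (F : Filtration ℕ mΩ) (x : ℕ → Ω → ℝ) (c : ℕ → ℝ) (f : ℝ → ℝ) (E : Set Ω) (ε δ : ℝ)
    (hδ0 : 0 ≤ δ) (hδ : δ < ε)
    (hx : ∀ n, Measurable[F n] (x n)) (hE : MeasurableSet[F 0] E) (hμE : 0 < μ E)
    (h0 : ∀ n ω, 0 ≤ x n ω) (h1 : ∀ n ω, x n ω ≤ 1)
    (hc : ∀ n, 0 ≤ c n) (hcs : ¬ Summable c)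
    (hf : Continuous f) (hf0 : f 0 = 0) (hfn : ∀ y, 0 < y → y ≤ ε → f y < 0)
    (hxE : ∀ ω ∈ E, x 0 ω ≤ δ)
    (hstep : ∀ n, μ[x (n+1) | F n] =ᵐ[μ] fun ω => x n ω + c n * f (x n ω)) :
    0 < μ {ω | Tendsto (fun n => x n ω) atTop (nhds 0)} := by
  set G := Gs x E ε with hG
  set V := Vs x E ε with hV
  have inv := Vs_inv x E ε h0 h1
  have hε : 0 < ε := by linarith
  have Gm : ∀ n, MeasurableSet[F n] (G n) := Gs_meas F x E ε hx hE
  have Gm' : ∀ n, MeasurableSet (G n) := fun n => F.le n _ (Gm n)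
  have Vm : ∀ n, Measurable[F n] (V n) := Vs_meas F x E ε hx hE
  have Vm' : ∀ n, Measurable (V n) := fun n => (Vm n).mono (F.le n) le_rfl
  have xm' : ∀ n, Measurable (x n) := fun n => (hx n).mono (F.le n) le_rfl
  have Em' : MeasurableSet E := F.le 0 _ hE
  have Vint : ∀ n, Integrable (V n) μ := fun n =>
    Integrable.of_bound (Vm' n).aestronglyMeasurable 1 (ae_of_all _ fun ω => by
      rw [Real.norm_eq_abs, abs_le]; constructor <;> linarith [(inv n ω).2.2.1, (inv n ω).2.2.2])
  have xint : ∀ n, Integrable (x n) μ := fun n =>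
    Integrable.of_bound (xm' n).aestronglyMeasurable 1 (ae_of_all _ fun ω => by
      rw [Real.norm_eq_abs, abs_le]; constructor <;> linarith [h0 n ω, h1 n ω])
  -- x < ε on G
  have Gx : ∀ n ω, ω ∈ G n → x n ω < ε := by
    intro n ω h
    cases n with
    | zero => exact (hxE ω h).trans_lt hδ
    | succ n => exact h.2
  let D : ℕ → Ω → ℝ := fun n => (G n).indicator (fun ω => - (c n * f (x n ω)))
  have Dnn : ∀ n ω, 0 ≤ D n ω := by
    intro n ω
    apply Set.indicator_nonneg
    intro ω h
    have hfx : f (x n ω) ≤ 0 := by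
      rcases (h0 n ω).eq_or_lt with h' | h'
      · rw [← h', hf0]
      · exact (hfn _ h' (Gx n ω h).le).le
    nlinarith [hc n]
  have Dm : ∀ n, Measurable (D n) := fun n =>
    (((hf.measurable.comp (xm' n)).const_mul _).neg).indicator (Gm' n)
  have Vstep : ∀ n, μ[V (n+1) | F n] =ᵐ[μ] fun ω => V n ω - D n ω := by
    intro n
    have e1 : μ[V (n+1) | F n] =ᵐ[μ]
        μ[V n | F n] + μ[(G n).indicator (x (n+1) - x n) | F n] :=
      condExp_add (Vint n) (((xint (n+1)).sub (xint n)).indicator (Gm' n)) _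
    have e2 : μ[V n | F n] = V n :=
      condExp_of_stronglyMeasurable (F.le n) (Vm n).stronglyMeasurable (Vint n)
    have e3 := condExp_indicator (m := F n) ((xint (n+1)).sub (xint n)) (Gm n)
    have e4 : μ[x (n+1) - x n | F n] =ᵐ[μ] μ[x (n+1) | F n] - μ[x n | F n] :=
      condExp_sub (xint (n+1)) (xint n) _
    have e5 : μ[x n | F n] = x n :=
      condExp_of_stronglyMeasurable (F.le n) (hx n).stronglyMeasurable (xint n)
    filter_upwards [e1, e3, e4, hstep n] with ω a1 a3 a4 a5
    rw [a1, Pi.add_apply, e2, a3]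
    by_cases h : ω ∈ G n
    · rw [Set.indicator_of_mem h, a4, Pi.sub_apply, a5, e5]
      simp only [D, Set.indicator_of_mem h]; ring
    · simp [D, Set.indicator_of_notMem h]
  have Dint : ∀ n, Integrable (D n) μ := by
    intro n
    have : Integrable (fun ω => V n ω - D n ω) μ := (integrable_condExp).congr (Vstep n)
    have := (Vint n).sub this
    refine this.congr (ae_of_all _ fun ω => ?_)
    simp
  have Vi : ∀ n, ∫ ω, V (n+1) ω ∂μ = ∫ ω, V n ω ∂μ - ∫ ω, D n ω ∂μ := by
    intro n
    rw [← integral_condExp (F.le n), integral_congr_ae (Vstep n), integral_sub (Vint n) (Dint n)]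
  have Vsum : ∀ n, ∫ ω, V n ω ∂μ + ∑ i ∈ Finset.range n, ∫ ω, D i ω ∂μ = ∫ ω, V 0 ω ∂μ := by
    intro n
    induction n with
    | zero => simp
    | succ n ih => rw [Finset.sum_range_succ, Vi]; linarith
  have Vnn : ∀ n, 0 ≤ ∫ ω, V n ω ∂μ := fun n => integral_nonneg fun ω => (inv n ω).2.2.1
  have Dinn : ∀ n, 0 ≤ ∫ ω, D n ω ∂μ := fun n => integral_nonneg fun ω => Dnn n ω
  have Dsummable : Summable (fun n => ∫ ω, D n ω ∂μ) :=
    summable_of_sum_range_le Dinn (c := ∫ ω, V 0 ω ∂μ) (fun n => by linarith [Vsum n, Vnn n])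
  have V0 : ∫ ω, V 0 ω ∂μ ≤ δ * μ.real E := by
    calc ∫ ω, V 0 ω ∂μ ≤ ∫ ω, E.indicator (fun _ => δ) ω ∂μ := by
          apply integral_mono (Vint 0) ((integrable_const δ).indicator Em')
          intro ω
          exact Set.indicator_le_indicator' (fun h => hxE ω h)
      _ = δ * μ.real E := by rw [integral_indicator_const _ Em', smul_eq_mul, mul_comm]
  have hEG : ∀ n, ε * μ.real (E \ G n) ≤ δ * μ.real E := by
    intro n
    have hle : ∫ ω, V n ω ∂μ ≤ ∫ ω, V 0 ω ∂μ := by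
      have := Vsum n
      have : 0 ≤ ∑ i ∈ Finset.range n, ∫ ω, D i ω ∂μ := Finset.sum_nonneg fun i _ => Dinn i
      linarith
    refine le_trans ?_ (hle.trans V0)
    calc ε * μ.real (E \ G n) = ∫ ω, (E \ G n).indicator (fun _ => ε) ω ∂μ := by
          rw [integral_indicator_const _ (Em'.diff (Gm' n)), smul_eq_mul, mul_comm]
      _ ≤ _ := by
          apply integral_mono ((integrable_const ε).indicator (Em'.diff (Gm' n))) (Vint n)
          intro ω
          by_cases h : ω ∈ E \ G n
          · simp only [Set.indicator_of_mem h]; exact (inv n ω).2.1 h.1 h.2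
          · simp only [Set.indicator_of_notMem h]; exact (inv n ω).2.2.1
  have hEpos : 0 < μ.real E := by
    rw [measureReal_def]; exact ENNReal.toReal_pos hμE.ne' (measure_ne_top _ _)
  have hGn : ∀ n, (1 - δ / ε) * μ.real E ≤ μ.real (G n) := by
    intro n
    have e : μ.real (E \ G n) = μ.real E - μ.real (G n) :=
      measureReal_sdiff (Gs_sub x E ε n) (Gm' n)
    have := hEG n
    rw [e] at this
    have h2 : μ.real E - μ.real (G n) ≤ δ * μ.real E / ε := by
      rw [le_div_iff₀ hε]; linarith
    have : (1 - δ / ε) * μ.real E = μ.real E - δ * μ.real E / ε := by ring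
    linarith
  have Ganti : Antitone G := antitone_nat_of_succ_le fun n => inter_subset_left
  have hGi : 0 < μ (⋂ n, G n) := by
    have t := tendsto_measure_iInter_atTop (μ := μ) (fun n => (Gm' n).nullMeasurableSet) Ganti
      ⟨0, measure_ne_top _ _⟩
    have hb : ENNReal.ofReal ((1 - δ / ε) * μ.real E) ≤ μ (⋂ n, G n) := by
      refine ge_of_tendsto' t fun n => ?_
      rw [Function.comp_apply, ← ofReal_measureReal (measure_ne_top μ (G n))]
      exact ENNReal.ofReal_le_ofReal (hGn n)
    refine lt_of_lt_of_le ?_ hb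
    rw [ENNReal.ofReal_pos]
    have : δ / ε < 1 := by rw [div_lt_one hε]; exact hδ
    exact mul_pos (by linarith) hEpos
  -- convergence
  have sub : Supermartingale V F μ := by
    apply supermartingale_nat (fun n => (Vm n).stronglyMeasurable) Vint
    intro n
    filter_upwards [Vstep n] with ω h
    rw [h]; linarith [Dnn n ω]
  have conv : ∀ᵐ ω ∂μ, ∃ L, Tendsto (fun n => V n ω) atTop (nhds L) := by
    have h := sub.neg.exists_ae_tendsto_of_bdd (R := 1) (by
      intro n
      refine (eLpNorm_le_of_ae_bound (C := 1) (ae_of_all _ fun ω => ?_)).trans ?_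
      · rw [Pi.neg_apply, Pi.neg_apply, norm_neg, Real.norm_eq_abs, abs_le]
        constructor <;> linarith [(inv n ω).2.2.1, (inv n ω).2.2.2]
      · simp)
    filter_upwards [h] with ω ⟨L, hL⟩
    exact ⟨-L, by simpa using hL.neg⟩
  have Dsum : ∀ᵐ ω ∂μ, Summable (fun n => D n ω) := by
    have e : ∫⁻ ω, ∑' n, ENNReal.ofReal (D n ω) ∂μ ≠ ⊤ := by
      rw [lintegral_tsum (fun n => (Dm n).ennreal_ofReal.aemeasurable)]
      have : ∀ n, ∫⁻ ω, ENNReal.ofReal (D n ω) ∂μ = ENNReal.ofReal (∫ ω, D n ω ∂μ) := fun n =>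
        (ofReal_integral_eq_lintegral_ofReal (Dint n) (ae_of_all _ (Dnn n))).symm
      simp_rw [this]
      exact Dsummable.tsum_ofReal_ne_top
    have := ae_lt_top' (AEMeasurable.tsum (fun n => (Dm n).ennreal_ofReal.aemeasurable)) e
    filter_upwards [this] with ω h
    have := ENNReal.summable_toReal h.ne
    refine this.congr fun n => ?_
    rw [ENNReal.toReal_ofReal (Dnn n ω)]
  refine lt_of_lt_of_le hGi (measure_mono_ae ?_)
  filter_upwards [conv, Dsum] with ω ⟨L, hL⟩ hD hω
  have hω' : ∀ n, ω ∈ G n := fun n => mem_iInter.1 hω n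
  have hxL : Tendsto (fun n => x n ω) atTop (nhds L) :=
    hL.congr fun n => (inv n ω).1 (hω' n)
  have hL0 : 0 ≤ L := ge_of_tendsto' hxL fun n => h0 n ω
  have hL1 : L ≤ ε := le_of_tendsto' hxL fun n => (Gx n ω (hω' n)).le
  rcases hL0.eq_or_lt with h | h
  · rw [← h] at hxL; exact hxL
  · exfalso
    have hfL := hfn L h hL1
    have ht : Tendsto (fun n => f (x n ω)) atTop (nhds (f L)) := (hf.tendsto L).comp hxL
    have ev : ∀ᶠ n in atTop, f (x n ω) < f L / 2 := ht.eventually_lt_const (by linarith)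
    obtain ⟨N, hN⟩ := eventually_atTop.1 ev
    apply hcs
    rw [← summable_nat_add_iff N]
    have hD' := ((summable_nat_add_iff N).2 hD).mul_left (2 / (- f L))
    refine Summable.of_nonneg_of_le (fun n => hc _) (fun n => ?_) hD'
    have hd : D (n + N) ω = - (c (n+N) * f (x (n+N) ω)) := Set.indicator_of_mem (hω' _) _
    rw [hd]
    have := hN (n+N) (by omega)
    have h3 := hc (n+N)
    have hp : 0 < - f L := by linarith
    rw [div_mul_eq_mul_div, le_div_iff₀ hp]
    nlinarith

lemma stay_pos {Ω : Type} [mΩ : MeasurableSpace Ω] (μ : Measure Ω) [IsProbabilityMeasure μ]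
    (F : Filtration ℕ mΩ) (z : ℕ → Ω → ℝ) (m : ℕ) (s : ℕ → ℝ) (z0 : ℝ)
    (hz : ∀ n, Measurable[F n] (z n)) (hz0 : ∀ ω, z 0 ω = z0) (hs : ∀ n, z0 < s n)
    (hspos : ∀ n, 0 < s n)
    (K : ℕ → Set Ω) (hK : ∀ n, MeasurableSet (K n)) (hKz : ∀ n, ∀ ω ∈ K n, z (n+1) ω = z n ω)
    (hstay : ∀ n, μ[(K n).indicator (fun _ => (1:ℝ)) | F n] =ᵐ[μ]
      fun ω => (1 - z n ω / s n) ^ m) (n : ℕ) : 0 < μ {ω | z n ω = z0} := by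
  induction n with
  | zero => simp [hz0]
  | succ n ih =>
    set E := {ω | z n ω = z0} with hE
    have Em : MeasurableSet[F n] E := hz n (measurableSet_singleton z0)
    have Em' := F.le n _ Em
    have i1 : ∫ ω in E, (K n).indicator (fun _ => (1:ℝ)) ω ∂μ = μ.real (K n ∩ E) := by
      rw [integral_indicator_const _ (hK n), smul_eq_mul, mul_one, measureReal_restrict_apply (hK n)]
    have i2 := setIntegral_condExp (μ := μ) (F.le n)
      ((integrable_const (1:ℝ)).indicator (hK n)) Em
    have i3 : ∫ ω in E, (μ[(K n).indicator (fun _ => (1:ℝ)) | F n]) ω ∂μ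
        = μ.real E * (1 - z0 / s n) ^ m := by
      rw [setIntegral_congr_ae (g := fun _ => (1 - z0 / s n) ^ m) Em', setIntegral_const, smul_eq_mul]
      filter_upwards [hstay n] with ω h hω
      rw [h, show z n ω = z0 from hω]
    have pos : 0 < μ.real (K n ∩ E) := by
      rw [← i1, ← i2, i3]
      apply mul_pos
      · rw [measureReal_def]; exact ENNReal.toReal_pos ih.ne' (measure_ne_top _ _)
      · apply pow_pos
        have : z0 / s n < 1 := by rw [div_lt_one (hspos n)]; exact hs n
        linarith
    have : 0 < μ (K n ∩ E) := by
      rw [measureReal_def] at pos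
      exact (ENNReal.toReal_pos_iff.1 pos).1
    refine this.trans_le (measure_mono ?_)
    rintro ω ⟨h1, h2⟩
    exact (hKz n ω h1).trans h2

theorem core2 {Ω : Type} [mΩ : MeasurableSpace Ω] (μ : Measure Ω) [IsProbabilityMeasure μ]
    (F : Filtration ℕ mΩ) (z : ℕ → Ω → ℝ) (m : ℕ) (hm : 1 ≤ m) (s0 z0 : ℝ) (f : ℝ → ℝ) (ε : ℝ)
    (hz : ∀ n, Measurable[F n] (z n)) (hz0 : ∀ ω, z 0 ω = z0) (hs : z0 < s0)
    (hzn : ∀ n ω, 0 ≤ z n ω) (hzs : ∀ n ω, z n ω ≤ s0 + 2 * m * n)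
    (K : ℕ → Set Ω) (hK : ∀ n, MeasurableSet (K n)) (hKz : ∀ n, ∀ ω ∈ K n, z (n+1) ω = z n ω)
    (hstay : ∀ n, μ[(K n).indicator (fun _ => (1:ℝ)) | F n] =ᵐ[μ]
      fun ω => (1 - z n ω / (s0 + 2 * m * n)) ^ m)
    (hε : 0 < ε) (hf : Continuous f) (hf0 : f 0 = 0) (hfn : ∀ y, 0 < y → y < ε → f y < 0)
    (hstep : ∀ n, μ[z (n+1) | F n] =ᵐ[μ] fun ω => z n ω + 2 * m * (z n ω / (s0 + 2 * m * n)
      + f (z n ω / (s0 + 2 * m * n)))) :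
    0 < μ {ω | Tendsto (fun n : ℕ => z n ω / (s0 + 2 * m * n)) atTop (nhds 0)} := by
  obtain ⟨ω0⟩ : Nonempty Ω := nonempty_of_isProbabilityMeasure μ
  have hz00 : 0 ≤ z0 := by rw [← hz0 ω0]; exact hzn 0 ω0
  have hm' : (1:ℝ) ≤ m := by exact_mod_cast hm
  have hspos : ∀ n : ℕ, 0 < s0 + 2 * m * n := fun n => by
    have : (0:ℝ) ≤ 2 * m * n := by positivity
    linarith
  have hst := stay_pos μ F z m (fun n => s0 + 2 * m * n) z0 hz hz0 (fun n => by
    have : (0:ℝ) ≤ 2 * m * n := by positivity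
    show z0 < s0 + 2 * m * n
    linarith) hspos K hK hKz hstay
  have sinf : Tendsto (fun n : ℕ => s0 + 2 * (m:ℝ) * n) atTop atTop :=
    tendsto_atTop_add_const_left _ _
      (tendsto_natCast_atTop_atTop.const_mul_atTop (by positivity))
  have t0 : Tendsto (fun n : ℕ => z0 / (s0 + 2 * (m:ℝ) * n)) atTop (nhds 0) :=
    sinf.const_div_atTop z0
  obtain ⟨N, hN⟩ := (t0.eventually_lt_const (half_pos hε)).exists
  let F' : Filtration ℕ mΩ := ⟨fun n => F (n + N), fun i j h => F.mono (by omega), fun i => F.le _⟩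
  have key := core μ F' (fun n ω => z (n + N) ω / (s0 + 2 * m * ((n + N : ℕ) : ℝ)))
    (fun n => 2 * m / (s0 + 2 * m * ((n + N + 1 : ℕ) : ℝ))) f {ω | z N ω = z0} (ε / 2)
    (z0 / (s0 + 2 * (m:ℝ) * N)) (div_nonneg hz00 (hspos N).le) hN
    (fun n => (hz (n + N)).div_const _)
    (by show MeasurableSet[F (0 + N)] _; rw [zero_add]; exact hz N (measurableSet_singleton z0))
    (hst N) (fun n ω => div_nonneg (hzn _ _) (hspos _).le)
    (fun n ω => by rw [div_le_one (hspos _)]; exact hzs _ _)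
    (fun n => div_nonneg (by positivity) (hspos _).le)
    (by
      intro hsum
      have h2 : Summable (fun n : ℕ => 2 * (m:ℝ) / (s0 + 2 * m * (n : ℝ))) := by
        rw [← summable_nat_add_iff (N + 1)]
        exact hsum
      apply Real.not_summable_one_div_natCast
      rw [← summable_nat_add_iff 1]
      have h3 := h2.mul_left (s0 / (2 * m) + 1)
      refine Summable.of_nonneg_of_le (fun n => by positivity) (fun n => ?_) h3
      have := hspos n
      have h4 : (0:ℝ) < n + 1 := by positivity
      have hs0 : 0 < s0 := by linarith
      push_cast
      have e : (s0 / (2 * m) + 1) * (2 * m / (s0 + 2 * m * n)) = (s0 + 2 * m) / (s0 + 2 * m * n) := by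
        field_simp
      rw [e, div_le_div_iff₀ h4 this]
      have hn0 : (0:ℝ) ≤ n := by positivity
      nlinarith [mul_nonneg hs0.le hn0])
    hf hf0 (fun y h1 h2 => hfn y h1 (by linarith))
    (by
      intro ω hω
      simp only [zero_add]
      rw [show z N ω = z0 from hω])
    (by
      intro n
      have e : (fun ω => z (n + 1 + N) ω / (s0 + 2 * m * ((n + 1 + N : ℕ) : ℝ))) =
        (s0 + 2 * m * ((n + 1 + N : ℕ) : ℝ))⁻¹ • z (n + N + 1) := by
        funext ω
        rw [show n + N + 1 = n + 1 + N by omega]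
        simp [div_eq_inv_mul]
      rw [e]
      have c1 := condExp_smul (μ := μ) (s0 + 2 * m * ((n + 1 + N : ℕ) : ℝ))⁻¹ (z (n + N + 1)) (F (n + N))
      filter_upwards [c1, hstep (n + N)] with ω h1 h2
      refine h1.trans ?_
      rw [Pi.smul_apply, h2, smul_eq_mul]
      have p1 := hspos (n + N)
      have p2 := hspos (n + N + 1)
      have e2 : (s0 + 2 * m * ((n + 1 + N : ℕ) : ℝ)) = (s0 + 2 * m * ((n + N : ℕ) : ℝ)) + 2 * m := by
        push_cast; ring
      have e3 : (s0 + 2 * m * ((n + N + 1 : ℕ) : ℝ)) = (s0 + 2 * m * ((n + N : ℕ) : ℝ)) + 2 * m := by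
        push_cast; ring
      rw [e3] at p2 
      rw [e2, e3]
      generalize f (z (n + N) ω / (s0 + 2 * m * ((n + N : ℕ) : ℝ))) = w
      generalize (s0 + 2 * m * ((n + N : ℕ) : ℝ)) = s at *
      generalize z (n + N) ω = y
      field_simp
      ring)
  refine key.trans_le (measure_mono ?_)
  intro ω hω
  exact (tendsto_add_atTop_iff_nat (f := fun n : ℕ => z n ω / (s0 + 2 * m * n)) N).1 hω

lemma squeeze_aux (b z : ℕ → ℝ) (C D s0 : ℝ) (m : ℕ) (hm : 1 ≤ m) (hC : 0 ≤ C) (hD : 0 ≤ D)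
    (hs : 0 < s0) (hz : ∀ n, 0 ≤ z n) (hb0 : ∀ n, 0 ≤ b n)
    (hb : ∀ n, b n ≤ (C + z n / m) / (D + n))
    (ht : Tendsto (fun n : ℕ => z n / (s0 + 2 * m * n)) atTop (nhds 0)) :
    Tendsto b atTop (nhds 0) := by
  have hm' : (1:ℝ) ≤ m := by exact_mod_cast hm
  have t1 : Tendsto (fun n : ℕ => C / (n:ℝ)) atTop (nhds 0) :=
    tendsto_natCast_atTop_atTop.const_div_atTop C
  have t2 := t1.add (ht.mul_const ((s0 + 2 * m) / m))
  rw [zero_mul, add_zero] at t2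
  refine tendsto_of_tendsto_of_tendsto_of_le_of_le' tendsto_const_nhds t2
    (Eventually.of_forall hb0) ?_
  filter_upwards [eventually_ge_atTop 1] with n hn
  have hn' : (1:ℝ) ≤ n := by exact_mod_cast hn
  refine (hb n).trans ?_
  have hzn := hz n
  have hS : 0 < s0 + 2 * m * n := by positivity
  calc (C + z n / m) / (D + n) ≤ (C + z n / m) / n := by
        apply div_le_div_of_nonneg_left _ (by linarith) (by linarith)
        positivity
    _ = C / n + z n * (1 / n) / m := by field_simp
    _ ≤ C / n + z n * ((s0 + 2 * m) / (s0 + 2 * m * n)) / m := by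
        have : 1 / (n:ℝ) ≤ (s0 + 2 * m) / (s0 + 2 * m * n) := by
          rw [div_le_div_iff₀ (by linarith) hS]
          nlinarith
        gcongr C / n + z n * ?_ / m
    _ = _ := by field_simp

lemma bern_one (m : ℕ) (x : ℝ) :
    ∑ k ∈ Finset.range (m + 1), (m.choose k : ℝ) * x ^ k * (1 - x) ^ (m - k) = 1 := by
  have := congrArg (Polynomial.eval x) (bernsteinPolynomial.sum ℝ m)
  simpa [bernsteinPolynomial, Polynomial.eval_finsetSum] using this

lemma bern_id (m : ℕ) (x : ℝ) :
    ∑ k ∈ Finset.range (m + 1), (k : ℝ) * ((m.choose k : ℝ) * x ^ k * (1 - x) ^ (m - k))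
      = m * x := by
  have := congrArg (Polynomial.eval x) (bernsteinPolynomial.sum_smul ℝ m)
  simpa [bernsteinPolynomial, Polynomial.eval_finsetSum] using this

lemma polyP_cont (m : ℕ) (p : ℕ → ℝ) : Continuous (polyP m p) := by
  unfold polyP; fun_prop

lemma polyP_zero (m : ℕ) (p : ℕ → ℝ) : polyP m p 0 = 1 / 2 * p 0 := by
  unfold polyP
  rw [Finset.sum_eq_single 0]
  · simp
  · intro k _ hk; simp [hk]
  · simp

lemma polyP_one (m : ℕ) (hm : 1 ≤ m) (p : ℕ → ℝ) : polyP m p 1 = 1 / 2 * (p m - 1) := by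
  unfold polyP
  rw [Finset.sum_eq_single m]
  · have : (m:ℝ) ≠ 0 := by positivity
    simp [this]
  · intro k hk hkm
    have : m - k ≠ 0 := by simp at hk; omega
    simp [this]
  · simp

namespace PAProcess

variable {Ω : Type} [MeasurableSpace Ω] (P : PAProcess Ω)

def sr (n : ℕ) : ℝ := (P.X0 : ℝ) + P.Y0 + 2 * P.m * n

def R (n k : ℕ) : Set Ω := {ω | P.A (n + 1) ω = P.A n ω + 1 ∧ P.X (n + 1) ω = P.X n ω + k + P.m}

def Bl (n k : ℕ) : Set Ω := {ω | P.A (n + 1) ω = P.A n ω ∧ P.X (n + 1) ω = P.X n ω + k}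

def T (w1 w2 : ℕ → ℝ) (n : ℕ) : Ω → ℝ := ∑ k ∈ Finset.range (P.m + 1),
  (w1 k • (P.R n k).indicator (fun _ => (1:ℝ)) + w2 k • (P.Bl n k).indicator (fun _ => (1:ℝ)))

def bb (n k : ℕ) (ω : Ω) : ℝ := (P.m.choose k : ℝ) * ((P.X n ω : ℝ) / P.sr n) ^ k *
  (1 - (P.X n ω : ℝ) / P.sr n) ^ (P.m - k)

lemma mA (n : ℕ) : Measurable (P.A n) := (P.adaptedA n).mono (P.F.le n) le_rfl
lemma mX (n : ℕ) : Measurable (P.X n) := (P.adaptedX n).mono (P.F.le n) le_rfl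

lemma mR (n k : ℕ) : MeasurableSet (P.R n k) := by
  have h1 := P.mA n
  have h2 := P.mX n
  have h3 := P.mA (n+1)
  have h4 := P.mX (n+1)
  exact (measurableSet_eq_fun h3 (h1.add_const _)).inter
    (measurableSet_eq_fun h4 ((h2.add_const _).add_const _))

lemma mBl (n k : ℕ) : MeasurableSet (P.Bl n k) := by
  have h1 := P.mA n
  have h2 := P.mX n
  have h3 := P.mA (n+1)
  have h4 := P.mX (n+1)
  exact (measurableSet_eq_fun h3 h1).inter (measurableSet_eq_fun h4 (h2.add_const _))

lemma T_red (w1 w2 : ℕ → ℝ) (n k : ℕ) (hk : k ≤ P.m) (ω : Ω) (h : ω ∈ P.R n k) :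
    P.T w1 w2 n ω = w1 k := by
  unfold T
  rw [Finset.sum_apply, Finset.sum_eq_single k]
  · have : ω ∉ P.Bl n k := fun h' => by have := h.1; have := h'.1; omega
    simp [h, this]
  · intro j _ hj
    have h1 : ω ∉ P.Bl n j := fun h' => by have := h.1; have := h'.1; omega
    have h2 : ω ∉ P.R n j := fun h' => by have := h.2; have := h'.2; omega
    simp [h1, h2]
  · intro h; simp at h; omega

lemma T_blue (w1 w2 : ℕ → ℝ) (n k : ℕ) (hk : k ≤ P.m) (ω : Ω) (h : ω ∈ P.Bl n k) :
    P.T w1 w2 n ω = w2 k := by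
  unfold T
  rw [Finset.sum_apply, Finset.sum_eq_single k]
  · have : ω ∉ P.R n k := fun h' => by have := h.1; have := h'.1; omega
    simp [h, this]
  · intro j _ hj
    have h1 : ω ∉ P.R n j := fun h' => by have := h.1; have := h'.1; omega
    have h2 : ω ∉ P.Bl n j := fun h' => by have := h.2; have := h'.2; omega
    simp [h1, h2]
  · intro h; simp at h; omega

lemma intR (n k : ℕ) : Integrable ((P.R n k).indicator (fun _ => (1:ℝ))) P.μ := by
  have := P.isProb
  exact (integrable_const (1:ℝ)).indicator (P.mR n k)

lemma intBl (n k : ℕ) : Integrable ((P.Bl n k).indicator (fun _ => (1:ℝ))) P.μ := by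
  have := P.isProb
  exact (integrable_const (1:ℝ)).indicator (P.mBl n k)

lemma intT (w1 w2 : ℕ → ℝ) (n : ℕ) : Integrable (P.T w1 w2 n) P.μ :=
  integrable_finsetSum' _ fun k _ => ((P.intR n k).smul _).add ((P.intBl n k).smul _)

lemma condT (w1 w2 : ℕ → ℝ) (n : ℕ) : P.μ[P.T w1 w2 n | P.F n] =ᵐ[P.μ] fun ω =>
    ∑ k ∈ Finset.range (P.m + 1),
      (w1 k * (P.bb n k ω * P.p k) + w2 k * (P.bb n k ω * (1 - P.p k))) := by
  have := P.isProb
  have h1 := condExp_finsetSum (μ := P.μ) (s := Finset.range (P.m + 1))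
    (f := fun k => (w1 k • (P.R n k).indicator (fun _ => (1:ℝ)) +
      w2 k • (P.Bl n k).indicator (fun _ => (1:ℝ))))
    (fun k _ => ((P.intR n k).smul _).add ((P.intBl n k).smul _)) (P.F n)
  have h2 : ∀ k, k ≤ P.m → P.μ[(w1 k • (P.R n k).indicator (fun _ => (1:ℝ)) +
      w2 k • (P.Bl n k).indicator (fun _ => (1:ℝ))) | P.F n] =ᵐ[P.μ] fun ω =>
        (w1 k * (P.bb n k ω * P.p k) + w2 k * (P.bb n k ω * (1 - P.p k))) := by
    intro k hk
    have a1 := condExp_add (μ := P.μ) ((P.intR n k).smul (w1 k)) ((P.intBl n k).smul (w2 k)) (P.F n)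
    have a2 := condExp_smul (μ := P.μ) (w1 k) ((P.R n k).indicator (fun _ => (1:ℝ))) (P.F n)
    have a3 := condExp_smul (μ := P.μ) (w2 k) ((P.Bl n k).indicator (fun _ => (1:ℝ))) (P.F n)
    have a4 := P.step_red n k hk
    have a5 := P.step_blue n k hk
    filter_upwards [a1, a2, a3, a4, a5] with ω b1 b2 b3 b4 b5
    rw [b1, Pi.add_apply, b2, b3, Pi.smul_apply, Pi.smul_apply]
    unfold R Bl
    rw [b4, b5]
    simp only [bb, sr, smul_eq_mul]
  have h3 : ∀ᵐ ω ∂P.μ, ∀ k, k ≤ P.m → (P.μ[(w1 k • (P.R n k).indicator (fun _ => (1:ℝ)) +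
      w2 k • (P.Bl n k).indicator (fun _ => (1:ℝ))) | P.F n]) ω =
        (w1 k * (P.bb n k ω * P.p k) + w2 k * (P.bb n k ω * (1 - P.p k))) := by
    rw [ae_all_iff]; intro k
    by_cases hk : k ≤ P.m
    · filter_upwards [h2 k hk] with ω h _ using h
    · exact ae_of_all _ fun ω h => absurd h hk
  filter_upwards [h1, h3] with ω b1 b3
  refine b1.trans ?_
  rw [Finset.sum_apply]
  refine Finset.sum_congr rfl fun k hk => b3 k (by simp at hk; omega)

lemma ae_step (n : ℕ) : ∀ᵐ ω ∂P.μ, ∃ k ≤ P.m, ω ∈ P.R n k ∨ ω ∈ P.Bl n k := by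
  have := P.isProb
  have hT : ∫ ω, P.T (fun _ => 1) (fun _ => 1) n ω ∂P.μ = 1 := by
    rw [← integral_condExp (P.F.le n), integral_congr_ae (P.condT _ _ n)]
    have : ∀ ω, ∑ k ∈ Finset.range (P.m + 1),
        ((1:ℝ) * (P.bb n k ω * P.p k) + 1 * (P.bb n k ω * (1 - P.p k))) = 1 := by
      intro ω
      refine Eq.trans ?_ (bern_one P.m ((P.X n ω : ℝ) / P.sr n))
      refine Finset.sum_congr rfl fun k _ => ?_
      rw [bb]; ring
    simp only [this]
    simp
  have hz : ∀ ω, (¬ ∃ k ≤ P.m, ω ∈ P.R n k ∨ ω ∈ P.Bl n k) →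
      P.T (fun _ => 1) (fun _ => 1) n ω = 0 := by
    intro ω h
    unfold T
    rw [Finset.sum_apply]
    refine Finset.sum_eq_zero fun k hk => ?_
    have hk' : k ≤ P.m := by simp at hk; omega
    have h1 : ω ∉ P.R n k := fun h' => h ⟨k, hk', Or.inl h'⟩
    have h2 : ω ∉ P.Bl n k := fun h' => h ⟨k, hk', Or.inr h'⟩
    simp [h1, h2]
  have hle : ∀ ω, 0 ≤ 1 - P.T (fun _ => 1) (fun _ => 1) n ω := by
    intro ω
    by_cases h : ∃ k ≤ P.m, ω ∈ P.R n k ∨ ω ∈ P.Bl n k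
    · obtain ⟨k, hk, h | h⟩ := h
      · rw [P.T_red _ _ n k hk ω h]; simp
      · rw [P.T_blue _ _ n k hk ω h]; simp
    · rw [hz ω h]; simp
  have i0 : ∫ ω, (1 - P.T (fun _ => 1) (fun _ => 1) n ω) ∂P.μ = 0 := by
    rw [integral_sub (integrable_const _) (P.intT _ _ n), hT]; simp
  rw [integral_eq_zero_iff_of_nonneg hle ((integrable_const _).sub (P.intT _ _ n))] at i0
  filter_upwards [i0] with ω h
  by_contra hc
  rw [hz ω hc] at h
  simp at h

lemma sr_pos (hX0 : 0 < P.X0) (n : ℕ) : 0 < P.sr n := by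
  unfold sr
  have : (0:ℝ) < P.X0 := by exact_mod_cast hX0
  positivity

lemma X_le (n : ℕ) (ω : Ω) : (P.X n ω : ℝ) ≤ P.sr n := by
  unfold sr
  exact_mod_cast P.hXle n ω

lemma intX (n : ℕ) : Integrable (fun ω => (P.X n ω : ℝ)) P.μ := by
  have := P.isProb
  refine Integrable.of_bound (measurable_from_top.comp (P.mX n)).aestronglyMeasurable (P.sr n)
    (ae_of_all _ fun ω => ?_)
  rw [Real.norm_eq_abs, abs_of_nonneg (by positivity)]
  exact P.X_le n ω

lemma condX (n : ℕ) : P.μ[(fun ω => (P.X (n+1) ω : ℝ)) | P.F n] =ᵐ[P.μ] fun ω =>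
    (P.X n ω : ℝ) + 2 * P.m * ((P.X n ω : ℝ) / P.sr n + polyP P.m P.p ((P.X n ω : ℝ) / P.sr n)) := by
  have := P.isProb
  have hm0 : (P.m : ℝ) ≠ 0 := by have := P.hm; positivity
  have e : (fun ω => (P.X (n+1) ω : ℝ)) =ᵐ[P.μ] (fun ω => (P.X n ω : ℝ)) +
      P.T (fun k => k + P.m) (fun k => k) n := by
    filter_upwards [P.ae_step n] with ω h
    rw [Pi.add_apply]
    obtain ⟨k, hk, h | h⟩ := h
    · rw [P.T_red _ _ n k hk ω h, h.2]; push_cast; ring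
    · rw [P.T_blue _ _ n k hk ω h, h.2]; push_cast; ring
  have e2 := condExp_add (P.intX n) (P.intT (fun k => k + P.m) (fun k => k) n) (P.F n)
  have e3 : P.μ[(fun ω => (P.X n ω : ℝ)) | P.F n] = fun ω => (P.X n ω : ℝ) :=
    condExp_of_stronglyMeasurable (P.F.le n)
      (measurable_from_top.comp (P.adaptedX n)).stronglyMeasurable (P.intX n)
  filter_upwards [condExp_congr_ae (m := P.F n) e, e2, P.condT (fun k => k + P.m) (fun k => k) n]
    with ω h1 h2 h3
  rw [h1, h2, Pi.add_apply, e3, h3]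
  congr 1
  have b1 := bern_id P.m ((P.X n ω : ℝ) / P.sr n)
  rw [mul_add, mul_assoc 2 (P.m:ℝ), ← b1]
  unfold polyP
  rw [Finset.mul_sum, Finset.mul_sum, Finset.mul_sum, ← Finset.sum_add_distrib]
  refine Finset.sum_congr rfl fun k _ => ?_
  unfold bb
  field_simp
  ring

lemma ae_bound : ∀ᵐ ω ∂P.μ, ∀ n, P.m * P.A n ω + P.X0 ≤ P.X n ω + P.m * P.A0 ∧
    P.A n ω ≤ P.A0 + n ∧ P.X n ω + P.m * P.A0 ≤ P.m * P.A n ω + P.X0 + P.m * n := by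
  filter_upwards [ae_all_iff.2 P.ae_step] with ω h n
  induction n with
  | zero => simp [P.hA0, P.hX0]; omega
  | succ n ih =>
    obtain ⟨i1, i2, i3⟩ := ih
    obtain ⟨k, hk, ⟨h1, h2⟩ | ⟨h1, h2⟩⟩ := h n
    · rw [h1, h2, mul_add, mul_add]; omega
    · rw [h1, h2, mul_add]; omega

end PAProcess

theorem nonlinear_model_stable_endpoints
    {Ω : Type} [MeasurableSpace Ω] (P : PAProcess Ω)
    (hnonlin : ∃ k ≤ P.m, P.p k ≠ (k : ℝ) / P.m)
    (hX0 : 0 < P.X0) (hY0 : 0 < P.Y0) :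
    (((0 : ℝ) ∈ P.Zp ∧ ∃ ε > (0 : ℝ), ∀ y ∈ Set.Ioo (0 : ℝ) ε, P.poly y < 0) →
      0 < P.μ {ω | Tendsto (fun n => P.a n ω) atTop (nhds (0 : ℝ))}) ∧
    (((1 : ℝ) ∈ P.Zp ∧ ∃ ε > (0 : ℝ), ∀ y ∈ Set.Ioo (1 - ε) (1 : ℝ), 0 < P.poly y) →
      0 < P.μ {ω | Tendsto (fun n => P.a n ω) atTop (nhds (1 : ℝ))}) := by
  have := P.isProb
  have hX0' : (0:ℝ) < P.X0 := by exact_mod_cast hX0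
  have hY0' : (0:ℝ) < P.Y0 := by exact_mod_cast hY0
  have hs0 : (0:ℝ) < (P.X0:ℝ) + P.Y0 := by linarith
  have hm1 : (1:ℝ) ≤ P.m := by exact_mod_cast P.hm
  constructor
  · rintro ⟨⟨-, h0⟩, ε, hε, hneg⟩
    have hp0 : P.p 0 = 0 := by rw [polyP_zero] at h0; linarith
    have key := core2 P.μ P.F (fun n ω => (P.X n ω : ℝ)) P.m P.hm ((P.X0:ℝ) + P.Y0) P.X0
      (polyP P.m P.p) ε (fun n => measurable_from_top.comp (P.adaptedX n))
      (fun ω => by simp [P.hX0]) (by linarith) (fun n ω => by positivity) (fun n ω => P.X_le n ω)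
      (fun n => P.Bl n 0) (fun n => P.mBl n 0) (fun n ω h => by rw [h.2]; simp)
      (fun n => by
        filter_upwards [P.step_blue n 0 (Nat.zero_le _)] with ω h
        unfold PAProcess.Bl
        rw [h]; simp [hp0])
      hε (polyP_cont _ _) h0 (fun y h1 h2 => hneg y ⟨h1, h2⟩) (fun n => P.condX n)
    refine key.trans_le (measure_mono_ae ?_)
    filter_upwards [P.ae_bound] with ω hb ht
    refine squeeze_aux _ (fun n => (P.X n ω : ℝ)) P.A0 ((P.A0:ℝ) + P.B0) _ P.m P.hm
      (by positivity) (by positivity) hs0 (fun n => by positivity)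
      (fun n => by unfold PAProcess.a; positivity) (fun n => ?_) ht
    unfold PAProcess.a
    gcongr
    have h1 : (P.m : ℝ) * P.A n ω + P.X0 ≤ P.X n ω + P.m * P.A0 := by exact_mod_cast (hb n).1
    have : (P.A n ω : ℝ) ≤ ((P.m:ℝ) * P.A0 + P.X n ω) / P.m := by
      rw [le_div_iff₀ (by linarith)]; linarith
    refine this.trans (le_of_eq ?_)
    field_simp
  · rintro ⟨⟨-, h0⟩, ε, hε, hpos⟩
    have hpm : P.p P.m = 1 := by rw [polyP_one _ P.hm] at h0; linarith
    have key := core2 P.μ P.F (fun n ω => P.sr n - (P.X n ω : ℝ)) P.m P.hm ((P.X0:ℝ) + P.Y0) P.Y0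
      (fun y => - polyP P.m P.p (1 - y)) ε
      (fun n => (measurable_from_top.comp (P.adaptedX n)).const_sub _)
      (fun ω => by simp [P.hX0, PAProcess.sr]) (by linarith) (fun n ω => by linarith [P.X_le n ω])
      (fun n ω => by unfold PAProcess.sr; linarith [(P.X n ω).cast_nonneg (α := ℝ)])
      (fun n => P.R n P.m) (fun n => P.mR n P.m)
      (fun n ω h => by rw [h.2]; unfold PAProcess.sr; push_cast; ring)
      (fun n => by
        have hsp := P.sr_pos hX0 n
        filter_upwards [P.step_red n P.m le_rfl] with ω h
        unfold PAProcess.R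
        rw [h]
        have e : 1 - (P.sr n - (P.X n ω : ℝ)) / P.sr n = (P.X n ω : ℝ) / P.sr n := by
          field_simp; ring
        change _ = (1 - (P.sr n - (P.X n ω : ℝ)) / P.sr n) ^ P.m
        rw [e]
        simp [hpm, PAProcess.sr])
      hε (((polyP_cont _ _).comp (continuous_const.sub continuous_id)).neg) (by simpa using h0)
      (fun y h1 h2 => by
        have : 0 < polyP P.m P.p (1 - y) := hpos (1 - y) ⟨by linarith, by linarith⟩
        linarith)
      (fun n => by
        have hsp := P.sr_pos hX0 n
        have c1 := condExp_sub (μ := P.μ) (integrable_const (P.sr (n+1))) (P.intX (n+1)) (P.F n)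
        rw [condExp_const (P.F.le n)] at c1
        filter_upwards [c1, P.condX n] with ω h1 h2
        refine h1.trans ?_
        rw [Pi.sub_apply, h2]
        change _ = P.sr n - (P.X n ω : ℝ) + 2 * P.m * ((P.sr n - (P.X n ω : ℝ)) / P.sr n +
          - polyP P.m P.p (1 - (P.sr n - (P.X n ω : ℝ)) / P.sr n))
        have e : 1 - (P.sr n - (P.X n ω : ℝ)) / P.sr n = (P.X n ω : ℝ) / P.sr n := by
          field_simp; ring
        rw [e]
        have e2 : P.sr (n+1) = P.sr n + 2 * P.m := by unfold PAProcess.sr; push_cast; ring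
        rw [e2]
        generalize polyP P.m P.p ((P.X n ω : ℝ) / P.sr n) = w
        field_simp
        ring)
    refine key.trans_le (measure_mono_ae ?_)
    filter_upwards [P.ae_bound] with ω hb ht
    have hA : ∀ n, (P.A n ω : ℝ) ≤ P.A0 + n := fun n => by exact_mod_cast (hb n).2.1
    have hDn : (0:ℝ) ≤ (P.A0:ℝ) + P.B0 := by positivity
    -- if the denominators vanish at n = 0 only, use the shifted comparison
    have key2 : Tendsto (fun n => ((P.A0:ℝ) + P.B0 + n - P.A n ω) / ((P.A0:ℝ) + P.B0 + n))
        atTop (nhds 0) := by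
      refine squeeze_aux _ (fun n => P.sr n - (P.X n ω : ℝ)) P.B0 ((P.A0:ℝ) + P.B0) _ P.m P.hm
        (by positivity) hDn hs0 (fun n => by linarith [P.X_le n ω])
        (fun n => ?_) (fun n => ?_) ht
      · apply div_nonneg
        · linarith [hA n, (P.B0).cast_nonneg (α := ℝ)]
        · positivity
      · gcongr
        have h1 : (P.X n ω : ℝ) + P.m * P.A0 ≤ P.m * P.A n ω + P.X0 + P.m * n := by
          exact_mod_cast (hb n).2.2
        have : (P.A0:ℝ) + n - P.A n ω ≤ (P.sr n - (P.X n ω : ℝ)) / P.m := by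
          rw [le_div_iff₀ (by linarith)]
          unfold PAProcess.sr
          nlinarith
        linarith
    have key3 := key2.const_sub 1
    rw [sub_zero] at key3
    refine key3.congr' ?_
    filter_upwards [eventually_ge_atTop 1] with n hn
    have hn' : (1:ℝ) ≤ n := by exact_mod_cast hn
    have : (0:ℝ) < (P.A0:ℝ) + P.B0 + n := by linarith
    unfold PAProcess.a
    field_simp
    ring
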